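/- arXiv:1911.11202 — 4 statements merged into one kernel-verified Lean document; each statement's English description precedes it below -/
import Mathlib

section
/- Let α ∈ (0, 2) and let H : (0,∞) → (0,∞) be nonincreasing and regularly varying at infinity of index -α. For each R ≥ 1 let U_R and V_R be independent random variables with values in [1, ∞) and common tail distribution P(U_R > x) = P(V_R > x) = H(xR)/H(R) for all x ≥ 1. Then for every ε ∈ (0, α) there exists a constant C(ε) > 0 such that for all R ≥ 1 and all x ≥ 1 one has P(U_R · V_R > x) ≤ C(ε) / x^{α - ε}. -/
open MeasureTheory Filter Set ProbabilityTheory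

/-- Potter-type bound: a nonincreasing function, regularly varying of index `-α`, satisfies
`H (x R) / H R ≤ C x ^ (-β)` uniformly in `R, x ≥ 1`, for every `0 < β < α`. -/
theorem exists_potter_bound_of_antitoneOn {α β : ℝ} (hβ : 0 < β) (hβα : β < α) {H : ℝ → ℝ}
    (hHpos : ∀ R > 0, 0 < H R) (hHanti : AntitoneOn H (Set.Ioi 0))
    (hRV : Tendsto (fun y => H (2 * y) / H y) atTop (nhds ((2 : ℝ) ^ (-α)))) :
    ∃ C ≥ (1 : ℝ), ∀ R ≥ (1 : ℝ), ∀ x ≥ (1 : ℝ), H (x * R) / H R ≤ C * x ^ (-β) := by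
  have hlt : (2 : ℝ) ^ (-α) < 2 ^ (-β) :=
    Real.rpow_lt_rpow_of_exponent_lt (by norm_num) (by linarith)
  obtain ⟨Y₀, hY₀⟩ := eventually_atTop.1 (hRV.eventually_lt_const hlt)
  obtain ⟨Y, hY1, hY⟩ : ∃ Y ≥ (1 : ℝ), ∀ y ≥ Y, H (2 * y) ≤ 2 ^ (-β) * H y := by
    refine ⟨max Y₀ 1, le_max_right _ _, fun y hy => ?_⟩
    have hy1 : 1 ≤ y := (le_max_right _ _).trans hy
    exact ((div_lt_iff₀ (hHpos y (by linarith))).1 (hY₀ y ((le_max_left _ _).trans hy))).le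
  have hY0 : 0 < Y := by linarith
  have hiter : ∀ n : ℕ, ∀ y ≥ Y, H (2 ^ n * y) ≤ ((2 : ℝ) ^ n) ^ (-β) * H y := by
    intro n
    induction n with
    | zero => intro y _; simp
    | succ n ih =>
      intro y hy
      have h1 : Y ≤ 2 ^ n * y := by
        nlinarith [one_le_pow₀ (M₀ := ℝ) (a := 2) (n := n) (by norm_num)]
      calc H (2 ^ (n + 1) * y) = H (2 * (2 ^ n * y)) := by ring_nf
        _ ≤ 2 ^ (-β) * H (2 ^ n * y) := hY _ h1
        _ ≤ 2 ^ (-β) * (((2 : ℝ) ^ n) ^ (-β) * H y) := by gcongr; exact ih y hy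
        _ = ((2 : ℝ) ^ (n + 1)) ^ (-β) * H y := by
          rw [pow_succ, Real.mul_rpow (by positivity) (by norm_num)]; ring
  have hlarge : ∀ y ≥ Y, ∀ x ≥ (1 : ℝ), H (x * y) ≤ (x / 2) ^ (-β) * H y := by
    intro y hy x hx
    have hy0 : 0 < y := by linarith
    obtain ⟨n, hn, hn'⟩ := exists_nat_pow_near hx (y := (2 : ℝ)) (by norm_num)
    have hHy := (hHpos y hy0).le
    calc H (x * y) ≤ H (2 ^ n * y) :=
          hHanti (mem_Ioi.2 (by positivity)) (mem_Ioi.2 (by positivity)) (by gcongr)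
      _ ≤ ((2 : ℝ) ^ n) ^ (-β) * H y := hiter n y hy
      _ ≤ (x / 2) ^ (-β) * H y := by
        refine mul_le_mul_of_nonneg_right ?_ hHy
        refine Real.rpow_le_rpow_of_nonpos (by positivity) ?_ (by linarith)
        rw [pow_succ] at hn'
        linarith
  refine ⟨(2 * Y) ^ β, Real.one_le_rpow (by linarith) hβ.le, fun R hR x hx => ?_⟩
  have hR0 : 0 < R := by linarith
  have hx0 : 0 < x := by linarith
  have hHR := hHpos R hR0
  have hC : (2 * Y) ^ β * x ^ (-β) = (x / Y / 2) ^ (-β) := by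
    rw [show x / Y / 2 = (2 * Y)⁻¹ * x by field_simp,
      Real.mul_rpow (by positivity) hx0.le, Real.inv_rpow (by positivity),
      Real.rpow_neg (x := 2 * Y) (by positivity), inv_inv]
  rw [div_le_iff₀ hHR, hC]
  rcases le_total Y x with h | h
  · calc H (x * R) = H (x / Y * (Y * R)) := by congr 1; field_simp
      _ ≤ (x / Y / 2) ^ (-β) * H (Y * R) :=
        hlarge _ (by nlinarith) _ ((one_le_div hY0).2 h)
      _ ≤ (x / Y / 2) ^ (-β) * H R := by
        gcongr
        exact hHanti (mem_Ioi.2 hR0) (mem_Ioi.2 (by positivity)) (by nlinarith)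
  · have h1 : 1 ≤ (x / Y / 2) ^ (-β) := by
      refine Real.one_le_rpow_of_pos_of_le_one_of_nonpos (by positivity) ?_ (by linarith)
      have := (div_le_one hY0).2 h
      linarith
    have h2 : H (x * R) ≤ H R :=
      hHanti (mem_Ioi.2 hR0) (mem_Ioi.2 (by positivity)) (by nlinarith)
    nlinarith

/-- If `0 < x < 2 ^ (n + 1)` and two independent variables have tails at most `C t ^ (-β)`,
the first being at least `1`, then a dyadic decomposition bounds the tail of their product.
No measurability is required, since only subadditivity of the measure is used. -/
theorem measureReal_lt_mul_le_of_indepFun {Ω : Type*} [MeasurableSpace Ω]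
    {P : Measure Ω} [IsProbabilityMeasure P] {X Y : Ω → ℝ} (hX : ∀ᵐ ω ∂P, 1 ≤ X ω)
    (hXY : IndepFun X Y P) {C β : ℝ}
    (hXt : ∀ t > 0, P.real {ω | t < X ω} ≤ C * t ^ (-β))
    (hYt : ∀ t > 0, P.real {ω | t < Y ω} ≤ C * t ^ (-β))
    {x : ℝ} (hx : 0 < x) {n : ℕ} (hn : x < 2 ^ (n + 1)) :
    P.real {ω | x < X ω * Y ω} ≤
      C * x ^ (-β) + (n + 2) * (C ^ 2 * 2 ^ β * x ^ (-β)) := by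
  let A : ℕ → Set Ω := fun k => {ω | 2 ^ k / 2 < X ω} ∩ {ω | x / 2 ^ k < Y ω}
  have hcover : P.real {ω | x < X ω * Y ω} ≤
      P.real ({ω | x < X ω} ∪ ⋃ k ∈ Finset.range (n + 2), A k) := by
    refine ENNReal.toReal_mono (measure_ne_top _ _) (measure_mono_ae ?_)
    filter_upwards [hX] with ω h1 hω
    change x < X ω * Y ω at hω
    rcases lt_or_ge x (X ω) with h | h
    · exact Or.inl h
    right
    have hex : ∃ k : ℕ, X ω ≤ 2 ^ k := ⟨n + 1, h.trans hn.le⟩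
    classical
    have hle : X ω ≤ 2 ^ Nat.find hex := Nat.find_spec hex
    have hfind : Nat.find hex ≤ n + 1 := Nat.find_min' hex (h.trans hn.le)
    refine mem_iUnion₂.2 ⟨Nat.find hex, Finset.mem_range.2 (by omega), ?_, ?_⟩
    · change 2 ^ Nat.find hex / 2 < X ω
      rcases Nat.eq_zero_or_pos (Nat.find hex) with h0 | h0
      · rw [h0]; norm_num; linarith
      · have hmin := Nat.find_min hex (Nat.sub_lt h0 one_pos)
        obtain ⟨m, hm⟩ : ∃ m, Nat.find hex = m + 1 := ⟨_, (Nat.succ_pred_eq_of_pos h0).symm⟩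
        rw [hm] at hmin ⊢
        rw [Nat.add_sub_cancel, not_le] at hmin
        rw [pow_succ]
        linarith
    · change x / 2 ^ Nat.find hex < Y ω
      rw [div_lt_iff₀ (by positivity)]
      have hY : 0 < Y ω := by
        by_contra! hY
        nlinarith
      nlinarith
  have hA : ∀ k, P.real (A k) ≤ C ^ 2 * 2 ^ β * x ^ (-β) := by
    intro k
    have hmul : P.real (A k) = P.real {ω | 2 ^ k / 2 < X ω} * P.real {ω | x / 2 ^ k < Y ω} := by
      rw [measureReal_def, measureReal_def, measureReal_def, ← ENNReal.toReal_mul]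
      congr 1
      exact hXY.measure_inter_preimage_eq_mul (Ioi (2 ^ k / 2)) (Ioi (x / 2 ^ k))
        measurableSet_Ioi measurableSet_Ioi
    have h2 : (0 : ℝ) < 2 ^ k := by positivity
    calc P.real (A k)
        ≤ (C * (2 ^ k / 2) ^ (-β)) * (C * (x / 2 ^ k) ^ (-β)) := by
          rw [hmul]
          exact mul_le_mul (hXt _ (by positivity)) (hYt _ (by positivity)) measureReal_nonneg
            (measureReal_nonneg.trans (hXt _ (by positivity)))
      _ = C ^ 2 * ((2 ^ k / 2) * (x / 2 ^ k)) ^ (-β) := by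
          rw [Real.mul_rpow (by positivity) (by positivity)]; ring
      _ = C ^ 2 * (2⁻¹ * x) ^ (-β) := by congr 2; field_simp
      _ = C ^ 2 * 2 ^ β * x ^ (-β) := by
          rw [Real.mul_rpow (by positivity) hx.le, Real.inv_rpow (by positivity),
            Real.rpow_neg (x := 2) (by positivity), inv_inv]; ring
  calc P.real {ω | x < X ω * Y ω}
      ≤ P.real {ω | x < X ω} + P.real (⋃ k ∈ Finset.range (n + 2), A k) :=
        hcover.trans (measureReal_union_le _ _)
    _ ≤ C * x ^ (-β) + ∑ k ∈ Finset.range (n + 2), P.real (A k) := by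
        gcongr
        · exact hXt x hx
        · exact measureReal_biUnion_finset_le _ _
    _ ≤ C * x ^ (-β) + ∑ _k ∈ Finset.range (n + 2), C ^ 2 * 2 ^ β * x ^ (-β) := by
        gcongr with k
        exact hA k
    _ = C * x ^ (-β) + (n + 2) * (C ^ 2 * 2 ^ β * x ^ (-β)) := by simp

/-- Tail bound for the product of two independent Pareto-type random variables with
tail `H(xR)/H(R)`, where `H` is nonincreasing and regularly varying of index `-α`,
`α ∈ (0,2)`: for every `ε ∈ (0,α)` there is `C(ε) > 0` with
`P(U_R V_R > x) ≤ C(ε) x^{-(α-ε)}` for all `R ≥ 1`, `x ≥ 1`. -/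
theorem product_tail_bound {Ω : Type*} [MeasurableSpace Ω]
    (P : Measure Ω) [IsProbabilityMeasure P]
    (α : ℝ) (hα0 : 0 < α) (hα2 : α < 2)
    (H : ℝ → ℝ) (hHpos : ∀ R > 0, 0 < H R) (hHanti : AntitoneOn H (Set.Ioi 0))
    (hRV : ∀ x > 0, Tendsto (fun y => H (x * y) / H y) atTop (nhds (x ^ (-α))))
    (U V : ℝ → Ω → ℝ)
    (hU1 : ∀ R ≥ (1 : ℝ), ∀ᵐ ω ∂P, 1 ≤ U R ω)
    (hV1 : ∀ R ≥ (1 : ℝ), ∀ᵐ ω ∂P, 1 ≤ V R ω)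
    (hindep : ∀ R ≥ (1 : ℝ), IndepFun (U R) (V R) P)
    (hUtail : ∀ R ≥ (1 : ℝ), ∀ x ≥ (1 : ℝ),
      (P {ω | x < U R ω}).toReal = H (x * R) / H R)
    (hVtail : ∀ R ≥ (1 : ℝ), ∀ x ≥ (1 : ℝ),
      (P {ω | x < V R ω}).toReal = H (x * R) / H R) :
    ∀ ε, 0 < ε → ε < α → ∃ C > (0 : ℝ), ∀ R ≥ (1 : ℝ), ∀ x ≥ (1 : ℝ),
      (P {ω | x < U R ω * V R ω}).toReal ≤ C / x ^ (α - ε) := by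
  intro ε hε hεα
  obtain ⟨C, hC1, hC⟩ := exists_potter_bound_of_antitoneOn (β := α - ε / 2) (by linarith)
    (by linarith) hHpos hHanti (hRV 2 two_pos)
  have htail : ∀ Z : Ω → ℝ, ∀ R ≥ (1 : ℝ),
      (∀ x ≥ (1 : ℝ), (P {ω | x < Z ω}).toReal = H (x * R) / H R) →
      ∀ t > 0, P.real {ω | t < Z ω} ≤ C * t ^ (-(α - ε / 2)) := by
    intro Z R hR hZ t ht
    rcases le_total 1 t with h | h
    · exact (hZ t h).trans_le (hC R hR t h)
    · have h1 : 1 ≤ t ^ (-(α - ε / 2)) :=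
        Real.one_le_rpow_of_pos_of_le_one_of_nonpos ht h (by linarith)
      exact measureReal_le_one.trans (by nlinarith)
  have hC0 : 0 < C := by linarith
  have hlog2 : 0 < Real.log 2 := Real.log_pos one_lt_two
  let B := C ^ 2 * (2 : ℝ) ^ (α - ε / 2)
  have hB : 0 < B := by positivity
  refine ⟨C + (1 / (ε / 2 * Real.log 2) + 2) * B, by positivity, fun R hR x hx => ?_⟩
  have hx0 : 0 < x := by linarith
  obtain ⟨n, hn, hn'⟩ := exists_nat_pow_near hx (y := (2 : ℝ)) one_lt_two
  have hxδ : 1 ≤ x ^ (ε / 2) := Real.one_le_rpow hx (by linarith)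
  have hnx : (n : ℝ) ≤ 1 / (ε / 2 * Real.log 2) * x ^ (ε / 2) := by
    have h1 : n * Real.log 2 ≤ x ^ (ε / 2) / (ε / 2) := by
      rw [← Real.log_pow]
      exact (Real.log_le_log (by positivity) hn).trans
        (Real.log_le_rpow_div hx0.le (by positivity))
    calc (n : ℝ) ≤ x ^ (ε / 2) / (ε / 2) / Real.log 2 := (le_div_iff₀ hlog2).2 h1
      _ = _ := by field_simp
  have hfactor : C + (n + 2) * B ≤
      (C + (1 / (ε / 2 * Real.log 2) + 2) * B) * x ^ (ε / 2) := by
    have h1 : (n : ℝ) + 2 ≤ (1 / (ε / 2 * Real.log 2) + 2) * x ^ (ε / 2) := by linarith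
    nlinarith [mul_le_mul_of_nonneg_right h1 hB.le]
  calc (P {ω | x < U R ω * V R ω}).toReal
      ≤ C * x ^ (-(α - ε / 2)) + (n + 2) * (B * x ^ (-(α - ε / 2))) :=
        measureReal_lt_mul_le_of_indepFun (hU1 R hR) (hindep R hR)
          (htail _ R hR (hUtail R hR)) (htail _ R hR (hVtail R hR)) hx0 hn'
    _ = (C + (n + 2) * B) * x ^ (-(α - ε / 2)) := by ring
    _ ≤ (C + (1 / (ε / 2 * Real.log 2) + 2) * B) * x ^ (ε / 2) * x ^ (-(α - ε / 2)) := by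
        gcongr
    _ = (C + (1 / (ε / 2 * Real.log 2) + 2) * B) / x ^ (α - ε) := by
        rw [mul_assoc, ← Real.rpow_add hx0, div_eq_mul_inv _ (x ^ (α - ε)), ← Real.rpow_neg hx0.le]
        congr 2
        ring
end

section
/- Let α ∈ (0, 2) and let H : (0,∞) → (0,∞) be nonincreasing, regularly varying at infinity of index -α, and satisfy ∫_0^1 y H(y) dy < ∞. Define H̃(R) = α ∫_R^∞ (H(z)/z) dz for R > 0 (this integral is finite), so that H̃ is continuous, strictly decreasing, with H̃(R) → ∞ as R → 0+ and H̃(R) → 0 as R → ∞; for T > 0 let φ_T > 0 be the unique positive number with H̃(1/φ_T) = 1/T. Fix ρ ∈ [0, 1/α). Then for every λ > 0, lim_{T → ∞} λ T ∫_0^∞ e^{-λu} H(max(√u / φ_T, T^ρ)) du = Γ(1 - α/2) · λ^{α/2}, where Γ is the Gamma function. -/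
open MeasureTheory Filter Set

/-- A Potter-type bound: an upper bound for the growth of a nonincreasing regularly varying function
when its argument decreases. -/
lemma exists_potter_le_of_le {α p : ℝ} {H : ℝ → ℝ} (hHpos : ∀ R > 0, 0 < H R)
    (hHanti : AntitoneOn H (Ioi 0))
    (hRV : Tendsto (fun y => H (2 * y) / H y) atTop (nhds ((2 : ℝ) ^ (-α))))
    (hp0 : 0 ≤ p) (hp : α < p) :
    ∃ C > 0, ∃ X ≥ (1 : ℝ), ∀ r ≥ X, ∀ s, 1 ≤ s → s ≤ r → H s ≤ C * (r / s) ^ p * H r := by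
  have h2 : (2 : ℝ) ^ (-p) < 2 ^ (-α) := Real.rpow_lt_rpow_of_exponent_lt (by norm_num) (by linarith)
  obtain ⟨X, hX⟩ := eventually_atTop.1
    ((hRV.eventually (lt_mem_nhds h2)).and (eventually_ge_atTop 1))
  have hX1 : 1 ≤ X := (hX X le_rfl).2
  have hX0 : 0 < X := by linarith
  have step : ∀ y ≥ X, H y ≤ 2 ^ p * H (2 * y) := by
    intro y hy
    have hy0 : 0 < H y := hHpos y (by linarith)
    have h := (lt_div_iff₀ hy0).1 (hX y hy).1
    rw [Real.rpow_neg (by norm_num), inv_mul_lt_iff₀ (by positivity)] at h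
    exact h.le
  have iter : ∀ n : ℕ, ∀ y ≥ X, H y ≤ (2 ^ p) ^ n * H (2 ^ n * y) := by
    intro n
    induction n with
    | zero => intro y _; simp
    | succ n ih =>
      intro y hy
      have hle : X ≤ 2 ^ n * y := by
        nlinarith [one_le_pow₀ (show (1 : ℝ) ≤ 2 by norm_num) (n := n)]
      calc H y ≤ (2 ^ p) ^ n * H (2 ^ n * y) := ih y hy
        _ ≤ (2 ^ p) ^ n * (2 ^ p * H (2 * (2 ^ n * y))) := by
          gcongr
          exact step _ hle
        _ = _ := by rw [pow_succ, pow_succ, show 2 * (2 ^ n * y) = 2 ^ n * 2 * y by ring]; ring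
  have large : ∀ s ≥ X, ∀ r ≥ s, H s ≤ 2 ^ p * (r / s) ^ p * H r := by
    intro s hs r hr
    have hs0 : 0 < s := by linarith
    obtain ⟨n, hn1, hn2⟩ := exists_nat_pow_near ((one_le_div hs0).2 hr) (one_lt_two (α := ℝ))
    have hr2 : H (2 ^ (n + 1) * s) ≤ H r := by
      refine hHanti (mem_Ioi.2 (by linarith)) (mem_Ioi.2 (by positivity)) ?_
      exact ((div_lt_iff₀ hs0).1 hn2).le
    have hpow : ((2 : ℝ) ^ p) ^ n ≤ (r / s) ^ p := by
      rw [Real.rpow_pow_comm (by norm_num)]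
      gcongr
    have hHr := hHpos r (by linarith)
    calc H s ≤ (2 ^ p) ^ (n + 1) * H (2 ^ (n + 1) * s) := iter _ s hs
      _ ≤ (2 ^ p) ^ (n + 1) * H r := by gcongr
      _ = 2 ^ p * (2 ^ p) ^ n * H r := by ring
      _ ≤ _ := by gcongr
  have hHX := hHpos X hX0
  have hH1 := hHpos 1 one_pos
  refine ⟨H 1 / H X * 2 ^ p, by positivity, X, hX1, fun r hr s hs hsr => ?_⟩
  have hs0 : 0 < s := by linarith
  have hm := large (max s X) (le_max_right _ _) r (max_le hsr hr)
  have hHr := hHpos r (by linarith)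
  have hr0 : 0 < r := by linarith
  have hmax : H s ≤ H 1 / H X * H (max s X) := by
    rcases le_total s X with h | h
    · rw [max_eq_right h, div_mul_cancel₀ _ hHX.ne']
      exact hHanti (mem_Ioi.2 one_pos) (mem_Ioi.2 hs0) hs
    · rw [max_eq_left h]
      exact le_mul_of_one_le_left (hHpos s hs0).le
        ((one_le_div hHX).2 (hHanti (mem_Ioi.2 one_pos) (mem_Ioi.2 hX0) hX1))
  calc H s ≤ H 1 / H X * H (max s X) := hmax
    _ ≤ H 1 / H X * (2 ^ p * (r / max s X) ^ p * H r) := by gcongr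
    _ ≤ H 1 / H X * (2 ^ p * (r / s) ^ p * H r) := by
      gcongr
      exact le_max_left _ _
    _ = _ := by ring

/-- A Potter-type bound: a nonincreasing function which is regularly varying of index `-α` decays
at least like the power `-q`, uniformly, for each `q < α`. -/
lemma exists_potter_le_of_ge {α q : ℝ} {H : ℝ → ℝ} (hHpos : ∀ R > 0, 0 < H R)
    (hHanti : AntitoneOn H (Ioi 0))
    (hRV : Tendsto (fun y => H (2 * y) / H y) atTop (nhds ((2 : ℝ) ^ (-α))))
    (hq0 : 0 ≤ q) (hq : q < α) :
    ∃ X > 0, ∀ R ≥ X, ∀ x ≥ (1 : ℝ), H (R * x) ≤ 2 ^ q * x ^ (-q) * H R := by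
  have h2 : (2 : ℝ) ^ (-α) < 2 ^ (-q) := Real.rpow_lt_rpow_of_exponent_lt (by norm_num) (by linarith)
  obtain ⟨X, hX⟩ := eventually_atTop.1
    ((hRV.eventually (gt_mem_nhds h2)).and (eventually_ge_atTop 1))
  have hX1 : 1 ≤ X := (hX X le_rfl).2
  have step : ∀ y ≥ X, H (2 * y) ≤ 2 ^ (-q) * H y := by
    intro y hy
    exact ((div_lt_iff₀ (hHpos y (by linarith))).1 (hX y hy).1).le
  have iter : ∀ n : ℕ, ∀ y ≥ X, H (2 ^ n * y) ≤ (2 ^ (-q)) ^ n * H y := by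
    intro n
    induction n with
    | zero => intro y _; simp
    | succ n ih =>
      intro y hy
      have hle : X ≤ 2 ^ n * y := by
        nlinarith [one_le_pow₀ (show (1 : ℝ) ≤ 2 by norm_num) (n := n)]
      calc H (2 ^ (n + 1) * y) = H (2 * (2 ^ n * y)) := by congr 1; ring
        _ ≤ 2 ^ (-q) * H (2 ^ n * y) := step _ hle
        _ ≤ 2 ^ (-q) * ((2 ^ (-q)) ^ n * H y) := by
          gcongr
          exact ih y hy
        _ = _ := by ring
  refine ⟨X, by linarith, fun R hR x hx => ?_⟩
  have hR0 : 0 < R := by linarith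
  have hx0 : 0 < x := by linarith
  obtain ⟨n, hn1, hn2⟩ := exists_nat_pow_near hx (one_lt_two (α := ℝ))
  have hHR := hHpos R hR0
  have hpow : ((2 : ℝ) ^ (-q)) ^ n ≤ 2 ^ q * x ^ (-q) := by
    have hx2 : (2 : ℝ) ^ (-q) * (2 ^ (-q)) ^ n ≤ x ^ (-q) := by
      rw [← pow_succ', Real.rpow_pow_comm (by norm_num)]
      exact Real.rpow_le_rpow_of_nonpos hx0 hn2.le (by linarith)
    rwa [Real.rpow_neg (by norm_num) q, inv_mul_le_iff₀ (by positivity),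
      ← Real.rpow_neg (by norm_num) q] at hx2
  calc H (R * x) ≤ H (2 ^ n * R) := by
        refine hHanti (mem_Ioi.2 (by positivity)) (mem_Ioi.2 (by positivity)) ?_
        rw [mul_comm]
        gcongr
    _ ≤ (2 ^ (-q)) ^ n * H R := iter n R hR
    _ ≤ _ := by gcongr

/-- Karamata's theorem for the tail integral of `H z / z`. -/
lemma tendsto_karamata_tail {α : ℝ} (hα0 : 0 < α) {H : ℝ → ℝ} (hHpos : ∀ R > 0, 0 < H R)
    (hHanti : AntitoneOn H (Ioi 0))
    (hRV : ∀ x > 0, Tendsto (fun y => H (x * y) / H y) atTop (nhds (x ^ (-α)))) :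
    Tendsto (fun R => (α * ∫ z in Ioi R, H z / z) / H R) atTop (nhds 1) := by
  obtain ⟨X, hX0, hX⟩ := exists_potter_le_of_ge (q := α / 2) hHpos hHanti (hRV 2 two_pos)
    (by linarith) (by linarith)
  have key : Tendsto (fun R => ∫ x in Ioi (1 : ℝ), H (R * x) / H R / x) atTop
      (nhds (∫ x in Ioi (1 : ℝ), x ^ (-α - 1))) := by
    refine tendsto_integral_filter_of_dominated_convergence
      (fun x => 2 ^ (α / 2) * x ^ (-(α / 2) - 1)) ?_ ?_ ?_ ?_
    · filter_upwards [eventually_gt_atTop 0] with R hR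
      have hanti : AntitoneOn (fun x => H (R * x)) (Ioi 1) := by
        intro a ha b hb hab
        have ha' : 0 < a := one_pos.trans ha
        have hb' : 0 < b := one_pos.trans hb
        exact hHanti (mem_Ioi.2 (by positivity)) (mem_Ioi.2 (by positivity)) (by gcongr)
      exact (((aemeasurable_restrict_of_antitoneOn measurableSet_Ioi hanti).div_const _).div
        aemeasurable_id).aestronglyMeasurable
    · filter_upwards [eventually_ge_atTop X] with R hR
      filter_upwards [ae_restrict_mem measurableSet_Ioi] with x hx
      have hx1 : 1 < x := hx
      have hx0 : 0 < x := by linarith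
      have hR0 : 0 < R := by linarith
      have hHR := hHpos R hR0
      have hHRx := hHpos (R * x) (by positivity)
      rw [Real.norm_of_nonneg (by positivity), Real.rpow_sub_one hx0.ne', ← mul_div_assoc]
      gcongr
      exact (div_le_iff₀ hHR).2 (hX R hR x hx1.le)
    · exact (integrableOn_Ioi_rpow_of_lt (by linarith) one_pos).const_mul _
    · filter_upwards [ae_restrict_mem measurableSet_Ioi] with x hx
      have hx0 : (0 : ℝ) < x := one_pos.trans hx
      rw [Real.rpow_sub_one hx0.ne']
      simpa only [mul_comm x] using (hRV x hx0).div_const x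
  have hval : α * ∫ x in Ioi (1 : ℝ), x ^ (-α - 1) = 1 := by
    rw [integral_Ioi_rpow_of_lt (by linarith) one_pos]
    simp [hα0.ne']
  rw [← hval]
  refine (key.const_mul α).congr' ?_
  filter_upwards [eventually_gt_atTop 0] with R hR
  have hsub := integral_comp_mul_left_Ioi (fun z => H z / z) 1 hR
  rw [mul_one, smul_eq_mul] at hsub
  rw [mul_div_assoc]
  congr 1
  rw [eq_inv_mul_iff_mul_eq₀ hR.ne'] at hsub
  rw [← hsub, ← integral_const_mul, ← integral_div]
  refine setIntegral_congr_fun measurableSet_Ioi fun x hx => ?_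
  have hx0 : (0 : ℝ) < x := one_pos.trans hx
  have := hHpos R hR
  field_simp

/-- Convergence of the Laplace cumulant: if `H` is positive, nonincreasing, regularly varying
of index `-α` with `α ∈ (0,2)`, `∫₀¹ y H(y) dy < ∞`, `H̃(R) = α ∫_R^∞ H(z)/z dz` is finite,
and `φ_T > 0` solves `H̃(1/φ_T) = 1/T`, then for `ρ ∈ [0, 1/α)` and every `λ > 0`,
`λ T ∫₀^∞ e^{-λu} H(max(√u/φ_T, T^ρ)) du → Γ(1-α/2) λ^{α/2}` as `T → ∞`. -/
theorem laplace_cumulant_limit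
    (α : ℝ) (hα0 : 0 < α) (hα2 : α < 2)
    (H : ℝ → ℝ) (hHpos : ∀ R > 0, 0 < H R) (hHanti : AntitoneOn H (Set.Ioi 0))
    (hRV : ∀ x > 0, Tendsto (fun y => H (x * y) / H y) atTop (nhds (x ^ (-α))))
    (hint0 : IntegrableOn (fun y => y * H y) (Set.Ioc (0 : ℝ) 1))
    (hint : ∀ R > 0, IntegrableOn (fun z => H z / z) (Set.Ioi R))
    (φ : ℝ → ℝ) (hφpos : ∀ T > 0, 0 < φ T)
    (hφ : ∀ T > 0, α * ∫ z in Set.Ioi (1 / φ T), H z / z = 1 / T)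
    (ρ : ℝ) (hρ0 : 0 ≤ ρ) (hρ : ρ < 1 / α) :
    ∀ l > (0 : ℝ),
      Tendsto (fun T : ℝ => l * T * ∫ u in Set.Ioi (0 : ℝ),
          Real.exp (-l * u) * H (max (Real.sqrt u / φ T) (T ^ ρ))) atTop
        (nhds (Real.Gamma (1 - α / 2) * l ^ (α / 2))) := by
  intro l hl
  obtain ⟨r, hr⟩ : ∃ r : ℝ → ℝ, r = fun T => 1 / φ T := ⟨_, rfl⟩
  have hrT : ∀ T, r T = 1 / φ T := fun T => by rw [hr]
  have hrpos : ∀ T > 0, 0 < r T := fun T hT => by rw [hrT]; exact one_div_pos.2 (hφpos T hT)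
  have hrtop : Tendsto r atTop atTop := by
    refine tendsto_atTop.2 fun M => ?_
    obtain ⟨N, hN⟩ : ∃ N, N = max M 1 := ⟨_, rfl⟩
    have hN0 : 0 < N := hN ▸ lt_max_of_lt_right one_pos
    have hIpos : 0 < α * ∫ z in Ioi N, H z / z := by
      refine mul_pos hα0 ((setIntegral_pos_iff_support_of_nonneg_ae ?_ (hint N hN0)).2 ?_)
      · filter_upwards [ae_restrict_mem measurableSet_Ioi] with z hz
        have hz0 : 0 < z := hN0.trans hz
        exact (div_pos (hHpos z hz0) hz0).le
      · have hsub : Ioi N ⊆ Function.support (fun z => H z / z) ∩ Ioi N := fun z hz => by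
          have hz0 : 0 < z := hN0.trans hz
          exact ⟨(div_pos (hHpos z hz0) hz0).ne', hz⟩
        refine lt_of_lt_of_le ?_ (measure_mono hsub)
        simp
    have h0 : Tendsto (fun T : ℝ => 1 / T) atTop (nhds 0) := by
      simpa using tendsto_inv_atTop_zero (𝕜 := ℝ)
    filter_upwards [h0.eventually (gt_mem_nhds hIpos), eventually_gt_atTop 0] with T hT hT0
    by_contra! hlt
    have hle : r T ≤ N := hlt.le.trans (hN ▸ le_max_left _ _)
    rw [← hφ T hT0, ← hrT] at hT
    refine absurd hT (not_lt.2 (mul_le_mul_of_nonneg_left ?_ hα0.le))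
    refine setIntegral_mono_set (hint _ (hrpos T hT0)) ?_ (Ioi_subset_Ioi hle).eventuallyLE
    filter_upwards [ae_restrict_mem measurableSet_Ioi] with z hz
    have hz0 : 0 < z := (hrpos T hT0).trans hz
    exact (div_pos (hHpos z hz0) hz0).le
  have hTH : Tendsto (fun T => T * H (r T)) atTop (nhds 1) := by
    have h := ((tendsto_karamata_tail hα0 hHpos hHanti hRV).comp hrtop).inv₀ one_ne_zero
    rw [inv_one] at h
    refine h.congr' ?_
    filter_upwards [eventually_gt_atTop 0] with T hT
    simp only [Function.comp_apply]
    rw [hrT, hφ T hT, inv_div]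
    field_simp
  obtain ⟨p, hp, hp2, hpρ⟩ : ∃ p, α < p ∧ p < 2 ∧ ρ * p < 1 := by
    rcases hρ0.eq_or_lt with h | h
    · exact ⟨(α + 2) / 2, by linarith, by linarith, by rw [← h]; norm_num⟩
    · have h1 : α < 1 / ρ := (lt_one_div hα0 h).2 hρ
      obtain ⟨p, h3, h4⟩ := exists_between (lt_min hα2 h1)
      refine ⟨p, h3, h4.trans_le (min_le_left _ _), ?_⟩
      rw [mul_comm]
      exact (lt_div_iff₀ h).1 (h4.trans_le (min_le_right _ _))
  have hp0 : 0 < p := hα0.trans hp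
  obtain ⟨C, hC, X, hX1, hX⟩ := exists_potter_le_of_le hHpos hHanti (hRV 2 two_pos) hp0.le hp
  have hTρ : ∀ ε > 0, ∀ᶠ T in atTop, T ^ ρ ≤ ε * r T := by
    intro ε hε
    have hH1 := hHpos 1 one_pos
    have h0 : Tendsto (fun T : ℝ => T ^ (-(1 - ρ * p))) atTop (nhds 0) :=
      tendsto_rpow_neg_atTop (by linarith)
    have hcpos : 0 < ε ^ p * (H 1 / (C * 2)) := by positivity
    filter_upwards [h0.eventually (gt_mem_nhds hcpos), eventually_gt_atTop 0,
      hrtop.eventually_ge_atTop X, hTH.eventually (gt_mem_nhds one_lt_two)] with T h1 hT hrX h2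
    have hr0 := hrpos T hT
    have h3 := hX (r T) hrX 1 le_rfl (hX1.trans hrX)
    rw [div_one] at h3
    have h4 : T * H 1 ≤ C * 2 * r T ^ p := by
      calc T * H 1 ≤ T * (C * r T ^ p * H (r T)) := by gcongr
        _ = C * r T ^ p * (T * H (r T)) := by ring
        _ ≤ C * r T ^ p * 2 := by gcongr
        _ = _ := by ring
    rw [← Real.rpow_le_rpow_iff (by positivity) (by positivity) hp0,
      Real.mul_rpow hε.le hr0.le, ← Real.rpow_mul hT.le]
    have h5 : T ^ (ρ * p) = T ^ (-(1 - ρ * p)) * T := by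
      rw [← Real.rpow_add_one hT.ne']; congr 1; ring
    rw [h5]
    calc T ^ (-(1 - ρ * p)) * T ≤ ε ^ p * (H 1 / (C * 2)) * T := by gcongr
      _ = ε ^ p * (T * H 1 / (C * 2)) := by ring
      _ ≤ ε ^ p * r T ^ p := by
        gcongr
        rw [div_le_iff₀ (by positivity)]
        linarith
  have key : Tendsto (fun T : ℝ => ∫ u in Ioi (0 : ℝ),
      Real.exp (-l * u) * (T * H (max (Real.sqrt u / φ T) (T ^ ρ)))) atTop
      (nhds (∫ u in Ioi (0 : ℝ), Real.exp (-l * u) * u ^ (-(α / 2)))) := by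
    refine tendsto_integral_filter_of_dominated_convergence
      (fun u => 2 * (u ^ (0 : ℝ) * Real.exp (-l * u)) +
        2 * C * (u ^ (-(p / 2)) * Real.exp (-l * u))) ?_ ?_ ?_ ?_
    · filter_upwards [eventually_gt_atTop 0] with T hT
      have hanti : AntitoneOn (fun u => H (max (Real.sqrt u / φ T) (T ^ ρ))) (Ioi 0) := by
        intro a _ b _ hab
        have hTpos : 0 < T ^ ρ := Real.rpow_pos_of_pos hT _
        have hφT := hφpos T hT
        exact hHanti (mem_Ioi.2 (lt_max_of_lt_right hTpos)) (mem_Ioi.2 (lt_max_of_lt_right hTpos))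
          (by gcongr)
      refine (AEMeasurable.mul (by fun_prop) ?_).aestronglyMeasurable
      exact (aemeasurable_restrict_of_antitoneOn measurableSet_Ioi hanti).const_mul T
    · filter_upwards [eventually_ge_atTop 1, hrtop.eventually_ge_atTop X,
        hTH.eventually (gt_mem_nhds one_lt_two)] with T hT hrX h2
      filter_upwards [ae_restrict_mem measurableSet_Ioi] with u hu
      have hu0 : 0 < u := hu
      have hT0 : 0 < T := by linarith
      have hr0 := hrpos T hT0
      have hsu : 0 < √u := Real.sqrt_pos.2 hu0
      have hTρ1 : 1 ≤ T ^ ρ := Real.one_le_rpow hT hρ0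
      obtain ⟨m, hm⟩ : ∃ m, m = max (Real.sqrt u / φ T) (T ^ ρ) := ⟨_, rfl⟩
      have hm1 : 1 ≤ m := hTρ1.trans (hm ▸ le_max_right _ _)
      have hm2 : √u * r T ≤ m := by
        rw [hrT, mul_one_div]; exact hm ▸ le_max_left _ _
      have hm0 : 0 < m := by linarith
      have hHm := hHpos m hm0
      have hHr := hHpos _ hr0
      rw [← hm, Real.norm_of_nonneg (by positivity)]
      have hmain : T * H m ≤ 2 + 2 * C * u ^ (-(p / 2)) := by
        rcases le_total m (r T) with h | h
        · have hpow : (r T / m) ^ p ≤ u ^ (-(p / 2)) := by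
            have h6 : u ^ (-(p / 2)) = (1 / √u) ^ p := by
              rw [one_div, Real.inv_rpow hsu.le, Real.sqrt_eq_rpow, ← Real.rpow_mul hu0.le,
                ← Real.rpow_neg hu0.le]
              congr 1; ring
            rw [h6]
            have : r T / m ≤ 1 / √u := by
              rw [div_le_div_iff₀ hm0 hsu]; linarith
            gcongr
          calc T * H m ≤ T * (C * (r T / m) ^ p * H (r T)) := by
                gcongr
                exact hX _ hrX m hm1 h
            _ = C * (r T / m) ^ p * (T * H (r T)) := by ring
            _ ≤ C * u ^ (-(p / 2)) * 2 := by gcongr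
            _ ≤ _ := by linarith
        · have h7 : H m ≤ H (r T) := hHanti (mem_Ioi.2 hr0) (mem_Ioi.2 hm0) h
          have h8 : 0 < 2 * C * u ^ (-(p / 2)) := by positivity
          nlinarith
      rw [Real.rpow_zero]
      calc Real.exp (-l * u) * (T * H m)
          ≤ Real.exp (-l * u) * (2 + 2 * C * u ^ (-(p / 2))) := by gcongr
        _ = _ := by ring
    · have hI : ∀ s : ℝ, -1 < s →
          Integrable (fun u => u ^ s * Real.exp (-l * u)) (volume.restrict (Ioi 0)) := by
        intro s hs
        simpa [IntegrableOn] using integrableOn_rpow_mul_exp_neg_mul_rpow (p := 1) hs one_pos hl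
      exact ((hI 0 (by norm_num)).const_mul _).add ((hI _ (by linarith)).const_mul _)
    · filter_upwards [ae_restrict_mem measurableSet_Ioi] with u hu
      have hu0 : 0 < u := hu
      have hsu : 0 < √u := Real.sqrt_pos.2 hu0
      refine Tendsto.const_mul _ ?_
      have h := hTH.mul ((hRV _ hsu).comp hrtop)
      rw [one_mul, Real.sqrt_eq_rpow, ← Real.rpow_mul hu0.le, ← Real.sqrt_eq_rpow,
        show (1 / 2 : ℝ) * -α = -(α / 2) by ring] at h
      refine h.congr' ?_
      filter_upwards [hTρ _ hsu, eventually_gt_atTop 0] with T h1 hT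
      have hHr := hHpos _ (hrpos T hT)
      have hmax : max (√u / φ T) (T ^ ρ) = √u * r T := by
        rw [max_eq_left] <;> rw [← mul_one_div, ← hrT]
        exact h1
      rw [hmax, Function.comp_apply]
      field_simp
  have hval : l * ∫ u in Ioi (0 : ℝ), Real.exp (-l * u) * u ^ (-(α / 2)) =
      Real.Gamma (1 - α / 2) * l ^ (α / 2) := by
    have h := Real.integral_rpow_mul_exp_neg_mul_Ioi (a := 1 - α / 2) (r := l) (by linarith) hl
    have h9 : ∫ u in Ioi (0 : ℝ), Real.exp (-l * u) * u ^ (-(α / 2)) =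
        ∫ u in Ioi (0 : ℝ), u ^ (1 - α / 2 - 1) * Real.exp (-(l * u)) := by
      refine setIntegral_congr_fun measurableSet_Ioi fun u _ => ?_
      rw [mul_comm, neg_mul, show 1 - α / 2 - 1 = -(α / 2) by ring]
    rw [h9, h, one_div, Real.inv_rpow hl.le, ← Real.rpow_neg hl.le,
      show l ^ (α / 2) = l * l ^ (-(1 - α / 2)) by
        rw [← Real.rpow_one_add' hl.le (by linarith)]; congr 1; ring]
    ring
  rw [← hval]
  refine (key.const_mul l).congr fun T => ?_
  rw [mul_assoc]
  congr 1
  rw [← integral_const_mul]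
  refine integral_congr_ae (Eventually.of_forall fun u => ?_)
  simp only
  ring
end

section
/- Let α ∈ (0, 2). Let N be a standard Gaussian random variable and let S be a random variable, independent of N, that is almost surely positive and has Laplace transform E[e^{-λS}] = exp(-Γ(1 - α/2) · λ^{α/2}) for all λ ≥ 0. Then limsup_{x → +∞} x^{-α} · ln P(|N| / √S > x) < 0; in particular, there exist c > 0 and x₀ > 0 such that P(|N|/√S > x) ≤ exp(-c x^α) for all x ≥ x₀. -/
open MeasureTheory Filter ProbabilityTheory

lemma integrable_exp_sq_div_four_gaussianReal :
    Integrable (fun y : ℝ => Real.exp (y ^ 2 / 4)) (gaussianReal 0 1) := by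
  rw [gaussianReal_of_var_ne_zero 0 one_ne_zero,
    integrable_withDensity_iff (measurable_gaussianPDF 0 1)
      (ae_of_all _ fun _ => ENNReal.ofReal_lt_top)]
  refine ((integrable_exp_neg_mul_sq (b := 1 / 4) (by norm_num)).const_mul
    ((√(2 * Real.pi))⁻¹)).congr (ae_of_all _ fun y => ?_)
  simp only [toReal_gaussianPDF, gaussianPDFReal_def, NNReal.coe_one, mul_one, sub_zero]
  rw [mul_left_comm, ← Real.exp_add]
  ring_nf

/-- A Chernoff bound for the ratio of two independent variables, the numerator being
standard Gaussian. -/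
lemma measure_lt_abs_div_sqrt_le {Ω : Type*} [MeasurableSpace Ω]
    {P : Measure Ω} [IsProbabilityMeasure P] {N S : Ω → ℝ}
    (hN : Measure.map N P = gaussianReal 0 1) (hNm : AEMeasurable N P)
    (hSpos : ∀ᵐ ω ∂P, 0 < S ω) (hindep : IndepFun N S P) {x : ℝ} (hx : 0 ≤ x)
    (hS : Integrable (fun ω => Real.exp (-(x ^ 2 / 4) * S ω)) P) :
    (P {ω | x < |N ω| / Real.sqrt (S ω)}).toReal ≤
      (∫ y, Real.exp (y ^ 2 / 4) ∂gaussianReal 0 1) *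
        ∫ ω, Real.exp (-(x ^ 2 / 4) * S ω) ∂P := by
  have hexp : Measurable fun y : ℝ => Real.exp (y ^ 2 / 4) := by fun_prop
  have hNint : Integrable (fun ω => Real.exp (N ω ^ 2 / 4)) P := by
    have h := integrable_exp_sq_div_four_gaussianReal
    rw [← hN] at h
    exact h.comp_aemeasurable hNm
  have hind : IndepFun (fun ω => Real.exp (N ω ^ 2 / 4))
      (fun ω => Real.exp (-(x ^ 2 / 4) * S ω)) P :=
    hindep.comp hexp (ψ := fun s => Real.exp (-(x ^ 2 / 4) * s)) (by fun_prop)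
  have hprod := hind.integrable_mul hNint hS
  have hEN : ∫ y, Real.exp (y ^ 2 / 4) ∂gaussianReal 0 1 = ∫ ω, Real.exp (N ω ^ 2 / 4) ∂P := by
    rw [← hN, integral_map hNm hexp.aestronglyMeasurable]
  rw [hEN, ← hind.integral_fun_mul_eq_mul_integral hNint.1 hS.1]
  have hmarkov := mul_meas_ge_le_integral_of_nonneg
    (ae_of_all P fun ω => mul_nonneg (Real.exp_nonneg _) (Real.exp_nonneg _)) hprod 1
  rw [one_mul] at hmarkov
  refine le_trans (ENNReal.toReal_mono (measure_ne_top _ _) (measure_mono_ae ?_)) hmarkov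
  filter_upwards [hSpos] with ω hω hlt
  have hlt : x < |N ω| / √(S ω) := hlt
  rw [lt_div_iff₀ (Real.sqrt_pos.2 hω)] at hlt
  have hsq : (x * √(S ω)) ^ 2 ≤ |N ω| ^ 2 := by gcongr
  rw [mul_pow, Real.sq_sqrt hω.le, sq_abs] at hsq
  change 1 ≤ Real.exp (N ω ^ 2 / 4) * Real.exp (-(x ^ 2 / 4) * S ω)
  rw [← Real.exp_add]
  exact Real.one_le_exp (by linarith)

lemma measure_lt_abs_div_sqrt_pos {Ω : Type*} [MeasurableSpace Ω]
    {P : Measure Ω} [IsProbabilityMeasure P] {N S : Ω → ℝ}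
    (hN : Measure.map N P = gaussianReal 0 1) (hNm : AEMeasurable N P)
    (hSpos : ∀ᵐ ω ∂P, 0 < S ω) (hindep : IndepFun N S P) {x : ℝ} (hx : 0 ≤ x) :
    0 < P {ω | x < |N ω| / Real.sqrt (S ω)} := by
  obtain ⟨n, hn⟩ : ∃ n : ℕ, 0 < P (S ⁻¹' Set.Iic (n : ℝ)) := by
    apply exists_measure_pos_of_not_measure_iUnion_null
    have : (⋃ n : ℕ, S ⁻¹' Set.Iic (n : ℝ)) = Set.univ := by
      ext ω
      simpa using exists_nat_ge (S ω)
    simp [this]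
  have hgauss : 0 < P (N ⁻¹' Set.Ioi (x * √n)) := by
    rw [← Measure.map_apply_of_aemeasurable hNm measurableSet_Ioi, hN, pos_iff_ne_zero]
    intro h
    have := gaussianReal_absolutelyContinuous' 0 one_ne_zero h
    simp at this
  have hinter : 0 < P (N ⁻¹' Set.Ioi (x * √n) ∩ S ⁻¹' Set.Iic (n : ℝ)) := by
    rw [hindep.measure_inter_preimage_eq_mul _ _ measurableSet_Ioi measurableSet_Iic]
    exact ENNReal.mul_pos hgauss.ne' hn.ne'
  refine hinter.trans_le (measure_mono_ae ?_)
  filter_upwards [hSpos] with ω hω hmem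
  obtain ⟨h1, h2⟩ := hmem
  have h1 : x * √n < N ω := h1
  have h2 : S ω ≤ n := h2
  change x < |N ω| / √(S ω)
  rw [lt_div_iff₀ (Real.sqrt_pos.2 hω)]
  calc x * √(S ω) ≤ x * √n := by gcongr
    _ < N ω := h1
    _ ≤ |N ω| := le_abs_self _

/-- If `N` is standard Gaussian and `S` is an independent, a.s. positive random variable
with Laplace transform `E e^{-λS} = exp(-Γ(1-α/2) λ^{α/2})`, `α ∈ (0,2)`, then
`limsup_{x→∞} x^{-α} ln P(|N|/√S > x) < 0`; in particular `P(|N|/√S > x) ≤ exp(-c x^α)`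
for some `c > 0` and all large `x`. -/
theorem tail_of_mixed_normal {Ω : Type*} [MeasurableSpace Ω]
    (P : Measure Ω) [IsProbabilityMeasure P]
    (α : ℝ) (hα0 : 0 < α) (hα2 : α < 2)
    (N S : Ω → ℝ)
    (hN : Measure.map N P = gaussianReal 0 1)
    (hSpos : ∀ᵐ ω ∂P, 0 < S ω)
    (hindep : IndepFun N S P)
    (hLap : ∀ l ≥ (0 : ℝ), ∫ ω, Real.exp (-l * S ω) ∂P
      = Real.exp (-(Real.Gamma (1 - α / 2)) * l ^ (α / 2))) :
    Filter.limsup (fun x : ℝ =>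
        ((x ^ (-α) * Real.log (P {ω | x < |N ω| / Real.sqrt (S ω)}).toReal : ℝ) : EReal))
        Filter.atTop < 0
    ∧ ∃ c > (0 : ℝ), ∃ x₀ > (0 : ℝ), ∀ x ≥ x₀,
        (P {ω | x < |N ω| / Real.sqrt (S ω)}).toReal ≤ Real.exp (-c * x ^ α) := by
  have hNm : AEMeasurable N P := by
    apply AEMeasurable.of_map_ne_zero
    rw [hN]
    exact IsProbabilityMeasure.ne_zero _
  have hSint (l : ℝ) (hl : 0 ≤ l) : Integrable (fun ω => Real.exp (-l * S ω)) P := by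
    by_contra h
    exact (Real.exp_pos _).ne ((integral_undef h).symm.trans (hLap l hl))
  set C := ∫ y, Real.exp (y ^ 2 / 4) ∂gaussianReal 0 1
  set G := Real.Gamma (1 - α / 2)
  have hG : 0 < G := Real.Gamma_pos_of_pos (by linarith)
  obtain ⟨c, hc, hcG⟩ : ∃ c : ℝ, 0 < c ∧ G / 4 ^ (α / 2) = 2 * c :=
    ⟨G / 4 ^ (α / 2) / 2, by positivity, by ring⟩
  have hlarge : ∀ᶠ x : ℝ in atTop, C ≤ Real.exp (c * x ^ α) :=
    (Real.tendsto_exp_atTop.comp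
      ((tendsto_rpow_atTop hα0).const_mul_atTop hc)).eventually_ge_atTop C
  have hbound : ∀ᶠ x : ℝ in atTop,
      (P {ω | x < |N ω| / Real.sqrt (S ω)}).toReal ≤ Real.exp (-c * x ^ α) := by
    filter_upwards [hlarge, eventually_ge_atTop 0] with x hCx hx
    have h := measure_lt_abs_div_sqrt_le hN hNm hSpos hindep hx (hSint _ (by positivity))
    rw [hLap _ (by positivity), Real.div_rpow (by positivity) (by norm_num),
      ← Real.rpow_natCast_mul hx, show ((2 : ℕ) : ℝ) * (α / 2) = α by push_cast; ring] at h
    calc _ ≤ _ := h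
      _ ≤ Real.exp (c * x ^ α) * Real.exp (-G * (x ^ α / 4 ^ (α / 2))) := by gcongr
      _ = Real.exp (-c * x ^ α) := by
        rw [← Real.exp_add]
        congr 1
        linear_combination (-x ^ α) * hcG
  constructor
  · refine lt_of_le_of_lt (b := ((-c : ℝ) : EReal)) (limsup_le_of_le (h := ?_)) ?_
    · filter_upwards [hbound, eventually_gt_atTop 0] with x hxb hx
      have hpos : 0 < (P {ω | x < |N ω| / Real.sqrt (S ω)}).toReal :=
        ENNReal.toReal_pos (measure_lt_abs_div_sqrt_pos hN hNm hSpos hindep hx.le).ne'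
          (measure_ne_top _ _)
      have hlog := (Real.log_le_iff_le_exp hpos).2 hxb
      rw [EReal.coe_le_coe_iff]
      calc _ ≤ x ^ (-α) * (-c * x ^ α) := by gcongr
        _ = -c * (x ^ (-α) * x ^ α) := by ring
        _ = -c := by rw [← Real.rpow_add hx]; simp
    · exact_mod_cast neg_lt_zero.2 hc
  · obtain ⟨x₀, hx₀⟩ := eventually_atTop.1 hbound
    exact ⟨c, hc, max x₀ 1, by positivity, fun x hx => hx₀ x ((le_max_left _ _).trans hx)⟩
end

section
/- Let m ≥ 1 and 1 ≤ k ≤ m be integers, β > 0 and C₀ ≥ 1. Let W be a random variable with W ≥ 1 almost surely and P(W > x) ≤ C₀ · x^{-β} for all x ≥ 1, and let σ be a random variable independent of W with probability density f(u) = (m! / ((k-1)! (m-k)!)) · u^{k-1} (1-u)^{m-k} on [0, 1] (the Beta(k, m-k+1) density). Then for all a > 0, b > 0 and γ > 0, P(b · W · e^{-aσ} > γ) ≤ C₀ · (b/γ)^β · m! / ((m-k)! · (aβ)^k). -/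
open MeasureTheory ProbabilityTheory Set

/-- A discretised form of conditioning on `Y`; it does not need any measurability of `X`. -/
lemma ProbabilityTheory.IndepFun.measure_lt_comp_le_lintegral {Ω : Type*} [MeasurableSpace Ω]
    {P : Measure Ω} {X Y : Ω → ℝ} (hindep : IndepFun X Y P) (hY : AEMeasurable Y P)
    {g : ℝ → ℝ} (hg : Monotone g) {F : ℝ → ENNReal} (hF : Antitone F)
    (htail : ∀ s, P {ω | g s < X ω} ≤ F s) {δ : ℝ} (hδ : 0 < δ) :
    P {ω | g (Y ω) < X ω} ≤ ∫⁻ u, F (u - δ) ∂(P.map Y) := by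
  let I : ℤ → Set ℝ := fun j => Ico (j • δ) ((j + 1) • δ)
  have hI : ⋃ j, I j = univ := iUnion_Ico_zsmul hδ
  have hcover : {ω | g (Y ω) < X ω} ⊆ ⋃ j, X ⁻¹' Ioi (g (j • δ)) ∩ Y ⁻¹' I j := by
    intro ω hω
    obtain ⟨j, hj⟩ := mem_iUnion.1 (hI.symm ▸ mem_univ (Y ω) : Y ω ∈ ⋃ j, I j)
    exact mem_iUnion.2 ⟨j, (hg hj.1).trans_lt hω, hj⟩
  calc P {ω | g (Y ω) < X ω}
      ≤ ∑' j, P (X ⁻¹' Ioi (g (j • δ)) ∩ Y ⁻¹' I j) :=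
        (measure_mono hcover).trans (measure_iUnion_le _)
    _ ≤ ∑' j, ∫⁻ u in I j, F (u - δ) ∂(P.map Y) := by
        refine ENNReal.tsum_le_tsum fun j => ?_
        rw [hindep.measure_inter_preimage_eq_mul _ _ measurableSet_Ioi measurableSet_Ico,
          ← Measure.map_apply_of_aemeasurable hY measurableSet_Ico]
        calc _ ≤ F (j • δ) * P.map Y (I j) := by gcongr; exact htail _
          _ = ∫⁻ _ in I j, F (j • δ) ∂(P.map Y) := (setLIntegral_const _ _).symm
          _ ≤ _ := setLIntegral_mono' measurableSet_Ico fun u hu => hF (by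
              have := hu.2
              rw [add_smul, one_smul] at this
              linarith)
    _ = ∫⁻ u, F (u - δ) ∂(P.map Y) := by
        rw [← lintegral_iUnion (fun _ => measurableSet_Ico) (pairwise_disjoint_Ico_zsmul δ),
          iUnion_Ico_zsmul hδ, setLIntegral_univ]

lemma lintegral_Ioi_pow_mul_exp_neg {k : ℕ} (hk : 1 ≤ k) {r : ℝ} (hr : 0 < r) :
    ∫⁻ u in Ioi (0 : ℝ), ENNReal.ofReal (u ^ (k - 1) * Real.exp (-(r * u)))
      = ENNReal.ofReal ((k - 1).factorial / r ^ k) := by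
  have hint : ∫ u in Ioi (0 : ℝ), u ^ (k - 1) * Real.exp (-(r * u))
      = (k - 1).factorial / r ^ k := by
    have h := Real.integral_rpow_mul_exp_neg_mul_Ioi (a := k) (by exact_mod_cast hk) hr
    obtain ⟨j, rfl⟩ := Nat.exists_eq_add_of_le' hk
    simp only [Nat.cast_add, Nat.cast_one, add_sub_cancel_right, Real.rpow_natCast,
      Real.Gamma_nat_eq_factorial] at h
    rw [Nat.add_sub_cancel, h, ← Nat.cast_add_one, Real.rpow_natCast, one_div, inv_pow,
      inv_mul_eq_div]
  rw [← hint, ofReal_integral_eq_lintegral_ofReal]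
  · refine not_imp_comm.1 integral_undef ?_
    rw [hint]
    positivity
  · filter_upwards [ae_restrict_mem measurableSet_Ioi] with u hu
    have : (0 : ℝ) < u := hu
    positivity

/-- The density of the `Beta(k, m-k+1)` distribution. -/
noncomputable def betaOrderDensity (m k : ℕ) : ℝ → ENNReal :=
  Set.indicator (Set.Icc (0 : ℝ) 1)
    (fun u => ENNReal.ofReal ((m.factorial : ℝ) /
        ((k - 1).factorial * (m - k).factorial)
      * u ^ (k - 1) * (1 - u) ^ (m - k)))

lemma measurable_betaOrderDensity (m k : ℕ) : Measurable (betaOrderDensity m k) :=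
  Measurable.indicator (by fun_prop) measurableSet_Icc

lemma withDensity_betaOrderDensity_ne_zero (m k : ℕ) :
    (volume : Measure ℝ).withDensity (betaOrderDensity m k) ≠ 0 := by
  intro h
  rw [withDensity_eq_zero_iff (measurable_betaOrderDensity m k).aemeasurable] at h
  have hsub : Ioo (0 : ℝ) 1 ⊆ {u | ¬ betaOrderDensity m k u = (0 : ℝ → ENNReal) u} := by
    intro u hu
    have h0 : 0 < u := hu.1
    have h1 : 0 < 1 - u := sub_pos.2 hu.2
    rw [mem_ofPred_eq, betaOrderDensity, indicator_of_mem (Ioo_subset_Icc_self hu), Pi.zero_apply,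
      ENNReal.ofReal_eq_zero, not_le]
    positivity
  have := measure_mono_null hsub h
  simp at this

lemma lintegral_exp_neg_withDensity_betaOrderDensity_le {m k : ℕ} (hk : 1 ≤ k)
    {r : ℝ} (hr : 0 < r) :
    ∫⁻ u, ENNReal.ofReal (Real.exp (-(r * u)))
        ∂((volume : Measure ℝ).withDensity (betaOrderDensity m k))
      ≤ ENNReal.ofReal ((m.factorial : ℝ) / ((m - k).factorial * r ^ k)) := by
  set M : ℝ := (m.factorial : ℝ) / ((k - 1).factorial * (m - k).factorial) with hM
  have hM0 : 0 ≤ M := by positivity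
  rw [lintegral_withDensity_eq_lintegral_mul _ (measurable_betaOrderDensity m k) (by fun_prop)]
  calc _ ≤ ∫⁻ u, (Ici (0 : ℝ)).indicator (fun u => ENNReal.ofReal M *
          ENNReal.ofReal (u ^ (k - 1) * Real.exp (-(r * u)))) u := by
        refine lintegral_mono fun u => ?_
        by_cases hu : u ∈ Icc (0 : ℝ) 1
        · have h0 : 0 ≤ u := hu.1
          have h1 : 0 ≤ 1 - u := sub_nonneg.2 hu.2
          rw [indicator_of_mem (mem_Ici.2 h0), Pi.mul_apply, betaOrderDensity,
            indicator_of_mem hu, ← ENNReal.ofReal_mul (by positivity), ← ENNReal.ofReal_mul hM0,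
            ← hM]
          refine ENNReal.ofReal_le_ofReal ?_
          have h2 : (1 - u) ^ (m - k) ≤ 1 := pow_le_one₀ h1 (by linarith)
          calc _ ≤ M * u ^ (k - 1) * 1 * Real.exp (-(r * u)) := by gcongr
            _ = _ := by ring
        · simp [betaOrderDensity, hu]
    _ = ENNReal.ofReal M * ENNReal.ofReal ((k - 1).factorial / r ^ k) := by
        rw [lintegral_indicator measurableSet_Ici, setLIntegral_congr Ioi_ae_eq_Ici.symm,
          lintegral_const_mul _ (by fun_prop), lintegral_Ioi_pow_mul_exp_neg hk hr]
    _ = _ := by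
        rw [← ENNReal.ofReal_mul hM0, hM]
        congr 1
        field_simp

/-- If `W ≥ 1` a.s. has tail `P(W > x) ≤ C₀ x^{-β}` for `x ≥ 1`, and `σ` is independent of
`W` with the `Beta(k, m-k+1)` density `(m!/((k-1)!(m-k)!)) u^{k-1}(1-u)^{m-k}` on `[0,1]`,
then for all `a, b, γ > 0`,
`P(b W e^{-aσ} > γ) ≤ C₀ (b/γ)^β m! / ((m-k)! (aβ)^k)`. -/
theorem weighted_product_tail_bound {Ω : Type*} [MeasurableSpace Ω]
    (P : Measure Ω) [IsProbabilityMeasure P]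
    (m k : ℕ) (hm : 1 ≤ m) (hk1 : 1 ≤ k) (hkm : k ≤ m)
    (β C₀ : ℝ) (hβ : 0 < β) (hC₀ : 1 ≤ C₀)
    (W σ : Ω → ℝ)
    (hW1 : ∀ᵐ ω ∂P, 1 ≤ W ω)
    (hWtail : ∀ x ≥ (1 : ℝ), (P {ω | x < W ω}).toReal ≤ C₀ * x ^ (-β))
    (hindep : IndepFun W σ P)
    (hσ : Measure.map σ P = (volume : Measure ℝ).withDensity fun u =>
      Set.indicator (Set.Icc (0 : ℝ) 1)
        (fun u => ENNReal.ofReal ((m.factorial : ℝ) /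
            ((k - 1).factorial * (m - k).factorial)
          * u ^ (k - 1) * (1 - u) ^ (m - k))) u) :
    ∀ a > (0 : ℝ), ∀ b > (0 : ℝ), ∀ γ > (0 : ℝ),
      (P {ω | γ < b * W ω * Real.exp (-a * σ ω)}).toReal
        ≤ C₀ * (b / γ) ^ β * (m.factorial : ℝ)
            / ((m - k).factorial * (a * β) ^ k) := by
  intro a ha b hb γ hγ
  have hσ' : Measure.map σ P = (volume : Measure ℝ).withDensity (betaOrderDensity m k) := hσ
  have hσm : AEMeasurable σ P := by
    by_contra h
    exact withDensity_betaOrderDensity_ne_zero m k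
      (hσ'.symm.trans (Measure.map_of_not_aemeasurable h))
  have htail : ∀ x > (0 : ℝ), P {ω | x < W ω} ≤ ENNReal.ofReal (C₀ * x ^ (-β)) := by
    intro x hx
    rcases le_total 1 x with h | h
    · exact (ENNReal.le_ofReal_iff_toReal_le (measure_ne_top _ _) (by positivity)).2 (hWtail x h)
    · refine prob_le_one.trans (ENNReal.one_le_ofReal.2 ?_)
      exact one_le_mul_of_one_le_of_one_le hC₀
        (Real.one_le_rpow_of_pos_of_le_one_of_nonpos hx h (by linarith))
  set K : ℝ := C₀ * (b / γ) ^ β with hK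
  have hK0 : 0 ≤ K := by positivity
  set B : ℝ := (m.factorial : ℝ) / ((m - k).factorial * (a * β) ^ k) with hB
  let g : ℝ → ℝ := fun s => γ / b * Real.exp (a * s)
  have hgK : ∀ s, C₀ * g s ^ (-β) = K * Real.exp (-(a * β * s)) := by
    intro s
    rw [Real.mul_rpow (by positivity) (by positivity), ← Real.exp_mul,
      Real.rpow_neg (by positivity), ← Real.inv_rpow (by positivity), inv_div, hK, ← mul_assoc]
    congr 2
    ring
  have hset : {ω | γ < b * W ω * Real.exp (-a * σ ω)} = {ω | g (σ ω) < W ω} := by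
    ext ω
    simp only [mem_ofPred_eq, g]
    rw [div_mul_eq_mul_div, div_lt_iff₀ hb, neg_mul, Real.exp_neg, ← div_eq_mul_inv,
      lt_div_iff₀ (Real.exp_pos _), mul_comm b]
  have hδ : ∀ δ > (0 : ℝ), (P {ω | g (σ ω) < W ω}).toReal ≤ K * Real.exp (a * β * δ) * B := by
    intro δ hδ
    refine ENNReal.toReal_le_of_le_ofReal (by positivity) ?_
    refine (hindep.measure_lt_comp_le_lintegral hσm (g := g)
      (F := fun s => ENNReal.ofReal (K * Real.exp (-(a * β * s)))) ?_ ?_ ?_ hδ).trans ?_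
    · intro s t hst
      simp only [g]
      gcongr
    · intro s t hst
      simp only
      gcongr
    · intro s
      rw [← hgK]
      exact htail _ (by positivity)
    · calc _ = ∫⁻ u, ENNReal.ofReal (K * Real.exp (a * β * δ)) *
            ENNReal.ofReal (Real.exp (-(a * β * u))) ∂(P.map σ) := by
            refine lintegral_congr fun u => ?_
            rw [← ENNReal.ofReal_mul (by positivity), mul_assoc K, ← Real.exp_add]
            congr 3
            ring
        _ ≤ _ := by
            rw [lintegral_const_mul _ (by fun_prop), hσ',
              ENNReal.ofReal_mul (p := K * Real.exp (a * β * δ)) (by positivity)]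
            gcongr
            exact lintegral_exp_neg_withDensity_betaOrderDensity_le hk1 (by positivity)
  rw [hset, mul_div_assoc]
  have hlim : Filter.Tendsto (fun δ : ℝ => K * Real.exp (a * β * δ) * B)
      (nhdsWithin 0 (Ioi 0)) (nhds (K * B)) := by
    have hc : Continuous fun δ : ℝ => K * Real.exp (a * β * δ) * B := by fun_prop
    simpa using (hc.tendsto 0).mono_left nhdsWithin_le_nhds
  exact ge_of_tendsto hlim (Filter.eventually_of_mem self_mem_nhdsWithin hδ)
end
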